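/- Assume (T1) α|μ| > |1−αδ|, (T2) μ² > 4(1−αδ), (T3) μ > 0. Let U ⊆ ℝ² be open and let q : U → ℂ be differentiable with Im q(x,t) > 0, Re q(x,t) < z_P, and M₀(q(x,t), conj q(x,t); x, t) = 0 = M₁(q(x,t), conj q(x,t); x, t) for all (x,t) ∈ U. Then q satisfies the elliptic Whitham equations ∂ₜq + (1/α)(1 − 3q − conj q)·∂ₓq = 0 and ∂ₜ(conj q) + (1/α)(1 − 3·conj q − q)·∂ₓ(conj q) = 0 on U. -/

import Mathlib

open Complex Real Filter Set MeasureTheory ComplexConjugate Topology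

noncomputable section

/-- The inverse hyperbolic tangent. -/
def arctanh (x : ℝ) : ℝ := Real.log ((1 + x) / (1 - x)) / 2

/-- The hyperbolic secant. -/
def sech (x : ℝ) : ℝ := 1 / Real.cosh x

/-- The point `z_P = (1-αδ+αμ)/4`. -/
def zP (α δ μ : ℝ) : ℝ := (1 - α*δ + α*μ)/4

/-- The point `z_∞ = (1-αδ-αμ)/4`. -/
def zInf (α δ μ : ℝ) : ℝ := (1 - α*δ - α*μ)/4

/-- The discriminant `α⁴ + α²μ²/4 − α²(1−αδ)`. -/
def discrm (α δ μ : ℝ) : ℝ := α^4 + α^2*μ^2/4 - α^2*(1 - α*δ)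

/-- The point `z⁺`. -/
def zplus (α δ μ : ℝ) : ℝ := (1/2)*((1 - α*δ)/2 - α^2 + Real.sqrt (discrm α δ μ))

/-- The point `z⁻ = z_L`. -/
def zminus (α δ μ : ℝ) : ℝ := (1/2)*((1 - α*δ)/2 - α^2 - Real.sqrt (discrm α δ μ))

/-- `Ω(z) = (2/(iα))(z − (1−αδ)/4)`. -/
def Omg (α δ : ℝ) (z : ℂ) : ℂ := (2 / (Complex.I * α)) * (z - (1 - α * δ) / 4)

/-- `R(z) = e^{iπ/4}(−i(16z−μ²))^{1/2}` (principal branch). -/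
def Rf (μ : ℝ) (z : ℂ) : ℂ :=
  Complex.exp (Complex.I * (π : ℂ) / 4) * (-Complex.I * (16 * z - (μ:ℂ)^2)) ^ ((1:ℂ)/2)

/-- The reflection coefficient `s(z)` (Gamma-function formula). -/
def sRef (α δ μ ε : ℝ) (z : ℂ) : ℂ :=
  -(((2:ℂ) ^ (-(Complex.I * (μ:ℂ)) / (ε:ℂ)) * Complex.I * (ε:ℂ)) /
      (2 * Complex.exp (Complex.I * (π : ℂ) / 4) * (-Complex.I * z) ^ ((1:ℂ)/2))) *
    (Complex.Gamma (1/2 - Complex.I * (μ:ℂ) / (2*ε) - Omg α δ z / ε) /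
      Complex.Gamma (1/2 + Complex.I * (μ:ℂ) / (2*ε) + Omg α δ z / ε)) *
    ((Complex.Gamma (1/2 + Omg α δ z / ε - Rf μ z / (2*ε)) *
      Complex.Gamma (1/2 + Omg α δ z / ε + Rf μ z / (2*ε))) /
      (Complex.Gamma (-(Complex.I * (μ:ℂ)) / (2*ε) - Rf μ z / (2*ε)) *
        Complex.Gamma (-(Complex.I * (μ:ℂ)) / (2*ε) + Rf μ z / (2*ε))))

/-- The phase function `Φ(z)` obtained from Stirling asymptotics (principal branches). -/
def Phi (α δ μ : ℝ) (z : ℂ) : ℂ :=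
  -(μ:ℂ) * Complex.log 2
  + (4/(α:ℂ)) * (z - (zP α δ μ : ℂ)) * Complex.log ((2/(α:ℂ)) * ((zP α δ μ : ℂ) - z))
  + (((μ:ℂ) - Complex.I * Rf μ z)/2) * Complex.log ((-Complex.I * (μ:ℂ) - Rf μ z)/2)
  + (((μ:ℂ) + Complex.I * Rf μ z)/2) * Complex.log ((-Complex.I * (μ:ℂ) + Rf μ z)/2)
  - Complex.I * (Omg α δ z - Rf μ z / 2) * Complex.log (Omg α δ z - Rf μ z / 2)
  - Complex.I * (Omg α δ z + Rf μ z / 2) * Complex.log (Omg α δ z + Rf μ z / 2)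

/-- The point at parameter `u` on the oriented segment `𝓑` from `q` to `z_P`. -/
def segB (α δ μ : ℝ) (q : ℂ) (u : ℝ) : ℂ := q + (u:ℂ) * ((zP α δ μ : ℂ) - q)

/-- Characterization of the branch `S(z)` of `√((z−q)(z−conj q))` with branch cut
`𝓑 ∪ 𝓑*`, normalized by `S(z) = z + O(1)` at infinity (equivalently `S > 0` on
`(z_P, ∞)`), together with its boundary value `S₊` taken from the left of `𝓑`. -/
def SSpec (α δ μ : ℝ) (q : ℂ) (S Splus : ℂ → ℂ) : Prop :=
  DifferentiableOn ℂ S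
    ((segB α δ μ q '' Set.Icc 0 1 ∪ segB α δ μ (conj q) '' Set.Icc 0 1)ᶜ) ∧
  (∀ z ∈ (segB α δ μ q '' Set.Icc 0 1 ∪ segB α δ μ (conj q) '' Set.Icc 0 1)ᶜ,
    S z ^ 2 = (z - q) * (z - conj q)) ∧
  (∀ x : ℝ, zP α δ μ < x → S (x:ℂ) = (Real.sqrt ((x - q.re)^2 + q.im^2) : ℂ)) ∧
  (∀ u : ℝ, 0 < u → u < 1 →
    Filter.Tendsto
      (fun d : ℝ => S (segB α δ μ q u + (d:ℂ) * Complex.I * ((zP α δ μ : ℂ) - q)))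
      (𝓝[>] 0) (𝓝 (Splus (segB α δ μ q u))))

/-- The moment `I_p(q, conj q) = Im ∫_𝓑 Φ′(s) s^p / S₊(s) ds`. -/
def Ip (α δ μ : ℝ) (q : ℂ) (Splus : ℂ → ℂ) (p : ℕ) : ℝ :=
  (∫ u in (0:ℝ)..1,
      deriv (Phi α δ μ) (segB α δ μ q u) * (segB α δ μ q u)^p / Splus (segB α δ μ q u)
        * ((zP α δ μ : ℂ) - q)).im

/-- `M₀(q, conj q; x, t) = (2π/α²)(2(q+conj q)t + αx − t) + I₀`. -/
def M0 (α δ μ : ℝ) (q : ℂ) (Splus : ℂ → ℂ) (x t : ℝ) : ℝ :=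
  (2*π/α^2) * (2*(2*q.re)*t + α*x - t) + Ip α δ μ q Splus 0

/-- `M₁(q, conj q; x, t) = (π/α²)((3q² + 2|q|² + 3(conj q)²)t + (q+conj q)(αx−t)) + I₁`. -/
def M1 (α δ μ : ℝ) (q : ℂ) (Splus : ℂ → ℂ) (x t : ℝ) : ℝ :=
  (π/α^2) * ((6*(q^2).re + 2*‖q‖^2)*t + (2*q.re)*(α*x - t))
    + Ip α δ μ q Splus 1

/-- `M₀` built from an abstract moment function `I₀`. -/
def M0abs (α : ℝ) (I0 : ℂ → ℝ) (q : ℂ) (x t : ℝ) : ℝ :=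
  (2*π/α^2) * (2*(2*q.re)*t + α*x - t) + I0 q

/-- `M₁` built from an abstract moment function `I₁`. -/
def M1abs (α : ℝ) (I1 : ℂ → ℝ) (q : ℂ) (x t : ℝ) : ℝ :=
  (π/α^2) * ((6*(q^2).re + 2*‖q‖^2)*t + (2*q.re)*(α*x - t)) + I1 q

/-! ### The square root `z ^ (1/2)` -/

lemma cpow_half_sq (z : ℂ) : (z ^ ((1:ℂ)/2)) ^ 2 = z := by
  simp [← Complex.cpow_nat_mul]

lemma cpow_half_ne_zero {z : ℂ} (hz : z ≠ 0) : z ^ ((1:ℂ)/2) ≠ 0 := by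
  intro h
  apply hz
  rw [← cpow_half_sq z, h]
  simp

lemma norm_cpow_half_sq (z : ℂ) : ‖z ^ ((1:ℂ)/2)‖ ^ 2 = ‖z‖ := by
  rw [← norm_pow, cpow_half_sq]

lemma cpow_half_re_pos {z : ℂ} (hz : z ∈ slitPlane) : 0 < (z ^ ((1:ℂ)/2)).re := by
  have hz0 := slitPlane_ne_zero hz
  rw [Complex.cpow_def_of_ne_zero hz0, Complex.exp_re]
  have h1 : (Complex.log z * (1 / 2)).im = z.arg / 2 := by
    rw [show (1 / 2 : ℂ) = ((1 / 2 : ℝ) : ℂ) by push_cast; rfl, Complex.im_mul_ofReal,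
      Complex.log_im]
    ring
  rw [h1]
  have h2 := Complex.neg_pi_lt_arg z
  have h3 := (Complex.mem_slitPlane_iff_arg.1 hz).1
  have h4 : z.arg < π := lt_of_le_of_ne (Complex.arg_le_pi z) h3
  exact mul_pos (Real.exp_pos _) (Real.cos_pos_of_mem_Ioo ⟨by linarith, by linarith⟩)

lemma HasDerivAt.cpow_half {f : ℂ → ℂ} {f' x : ℂ} (hf : HasDerivAt f f' x)
    (hx : f x ∈ slitPlane) :
    HasDerivAt (fun y => f y ^ ((1:ℂ)/2)) (f' / (2 * f x ^ ((1:ℂ)/2))) x := by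
  have h := hf.cpow_const (c := (1:ℂ)/2) hx
  have hne := cpow_half_ne_zero (slitPlane_ne_zero hx)
  convert h using 1
  rw [Complex.cpow_sub _ _ (slitPlane_ne_zero hx), Complex.cpow_one]
  nth_rewrite 3 [← cpow_half_sq (f x)]
  field_simp

/-! ### The function `R` -/

lemma neg_I_mul_mem_slitPlane {μ : ℝ} {z : ℂ} (hz : 0 < z.im) :
    -Complex.I * (16 * z - (μ:ℂ)^2) ∈ slitPlane := by
  left
  have : (-Complex.I * (16 * z - (μ:ℂ)^2)).re = 16 * z.im := by
    rw [← Complex.ofReal_pow]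
    simp [-ofReal_pow]
  rw [this]
  positivity

lemma exp_I_pi_div_four_sq : Complex.exp (Complex.I * (π : ℂ) / 4) ^ 2 = Complex.I := by
  rw [← Complex.exp_nat_mul]
  conv_rhs => rw [← Complex.exp_pi_div_two_mul_I]
  congr 1
  push_cast
  ring

lemma Rf_sq (μ : ℝ) (z : ℂ) : Rf μ z ^ 2 = 16 * z - (μ:ℂ)^2 := by
  rw [Rf, mul_pow, cpow_half_sq, exp_I_pi_div_four_sq]
  linear_combination (-(16 * z - (μ:ℂ)^2)) * Complex.I_sq

lemma Rf_re_im_pos (μ : ℝ) {z : ℂ} (hz : 0 < z.im) :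
    0 < (Rf μ z).re ∧ 0 < (Rf μ z).im := by
  have hg := cpow_half_re_pos (neg_I_mul_mem_slitPlane (μ := μ) hz)
  have he : Complex.exp (Complex.I * (π : ℂ) / 4)
      = ((√2 / 2 : ℝ) : ℂ) + ((√2 / 2 : ℝ) : ℂ) * Complex.I := by
    rw [show Complex.I * (π : ℂ) / 4 = ((π / 4 : ℝ) : ℂ) * Complex.I by push_cast; ring,
      Complex.exp_mul_I, ← Complex.ofReal_cos, ← Complex.ofReal_sin, Real.cos_pi_div_four,
      Real.sin_pi_div_four]
  have hsum : 0 < (Rf μ z).re + (Rf μ z).im := by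
    have : (Rf μ z).re + (Rf μ z).im
        = √2 * ((-Complex.I * (16 * z - (μ:ℂ)^2)) ^ ((1:ℂ)/2)).re := by
      rw [Rf, he]
      generalize (-Complex.I * (16 * z - (μ:ℂ)^2)) ^ ((1:ℂ)/2) = g
      simp
      ring
    rw [this]
    positivity
  have hprod : 0 < (Rf μ z).re * (Rf μ z).im := by
    have h := congrArg Complex.im (Rf_sq μ z)
    rw [pow_two, Complex.mul_im, ← Complex.ofReal_pow] at h
    simp [-ofReal_pow] at h
    linarith
  rcases pos_and_pos_or_neg_and_neg_of_mul_pos hprod with h | h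
  · exact h
  · linarith [h.1, h.2]

lemma Rf_ne_zero (μ : ℝ) {z : ℂ} (hz : 0 < z.im) : Rf μ z ≠ 0 := by
  intro h
  have := (Rf_re_im_pos μ hz).1
  simp [h] at this

lemma hasDerivAt_Rf (μ : ℝ) {z : ℂ} (hz : 0 < z.im) :
    HasDerivAt (Rf μ) (8 / Rf μ z) z := by
  have hne := Rf_ne_zero μ hz
  have h0 : HasDerivAt (fun z : ℂ => -Complex.I * (16 * z - (μ:ℂ)^2)) (-Complex.I * 16) z := by
    simpa using (((hasDerivAt_id z).const_mul (16:ℂ)).sub_const ((μ:ℂ)^2)).const_mul (-Complex.I)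
  have h := (h0.cpow_half (neg_I_mul_mem_slitPlane hz)).const_mul
    (Complex.exp (Complex.I * (π : ℂ) / 4))
  refine h.congr_deriv ?_
  have hs := cpow_half_ne_zero (slitPlane_ne_zero (neg_I_mul_mem_slitPlane (μ := μ) hz))
  have he := exp_I_pi_div_four_sq
  have he0 := Complex.exp_ne_zero (Complex.I * (π : ℂ) / 4)
  rw [Rf]
  rw [mul_div_assoc', div_eq_div_iff (by simpa using hs) (mul_ne_zero he0 hs)]
  generalize (-Complex.I * (16 * z - (μ:ℂ)^2)) ^ ((1:ℂ)/2) = g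
  linear_combination (-16 * Complex.I * g) * he - 16 * g * Complex.I_sq

/-! ### The derivative of `Φ` in the upper half plane -/

lemma Omg_eq {α : ℝ} (hα : 0 < α) (δ : ℝ) (z : ℂ) :
    Omg α δ z = ((2 / α * z.im : ℝ) : ℂ)
      - ((2 / α * (z.re - (1 - α * δ) / 4) : ℝ) : ℂ) * Complex.I := by
  have hα' : (α:ℂ) ≠ 0 := by exact_mod_cast hα.ne'
  rw [Omg]
  conv_lhs => rw [← Complex.re_add_im z]
  push_cast
  field_simp
  linear_combination (4 * z.re - 1 + α * δ) * Complex.I_sq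

lemma Omg_add_re {α : ℝ} (hα : 0 < α) (δ μ : ℝ) {z : ℂ} (hz : 0 < z.im) :
    2 / α * z.im < (Omg α δ z + Rf μ z / 2).re := by
  have := (Rf_re_im_pos μ hz).1
  rw [Omg_eq hα]
  simp [-ofReal_mul, -ofReal_sub, -ofReal_div]
  linarith

lemma Omg_sub_mem_slitPlane {α δ μ : ℝ} (hα : 0 < α) (hT2 : μ^2 > 4*(1 - α*δ)) {z : ℂ}
    (hz : 0 < z.im) : Omg α δ z - Rf μ z / 2 ∈ slitPlane := by
  rw [Complex.mem_slitPlane_iff]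
  by_contra! hcon
  obtain ⟨hre, him⟩ := hcon
  obtain ⟨h1, h2⟩ := Rf_re_im_pos μ hz
  have hsq := Rf_sq μ z
  have hsqr := congrArg Complex.re hsq
  have hsqi := congrArg Complex.im hsq
  rw [pow_two, Complex.mul_re, ← Complex.ofReal_pow] at hsqr
  rw [pow_two, Complex.mul_im, ← Complex.ofReal_pow] at hsqi
  simp [-ofReal_pow] at hsqr hsqi
  rw [Omg_eq hα] at hre him
  simp [-ofReal_mul, -ofReal_sub, -ofReal_div] at hre him
  set a := (Rf μ z).re
  set b := (Rf μ z).im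
  have hX : a / 2 ≥ 2 / α * z.im := by linarith
  have hY : z.re - (1 - α * δ) / 4 = - (α * b / 4) := by
    field_simp at him ⊢
    linarith
  have hzi : z.im = a * b / 8 := by linarith
  have hb : b ≤ 2 * α := by
    rw [hzi] at hX
    have : 2 / α * (a * b / 8) = a / 2 * (b / (2 * α)) := by field_simp; ring
    rw [this] at hX
    have h3 : b / (2 * α) ≤ 1 := by
      by_contra! h4
      nlinarith
    rwa [div_le_one (by positivity)] at h3
  nlinarith [mul_pos h2 hα, mul_pos h1 h1]

/-- The derivative of `Φ` in the upper half plane. -/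
def dPhi (α δ μ : ℝ) (z : ℂ) : ℂ :=
  (4/(α:ℂ)) * Complex.log ((2/(α:ℂ)) * ((zP α δ μ : ℂ) - z))
  + (4 * Complex.I / Rf μ z) * (Complex.log ((-Complex.I * (μ:ℂ) + Rf μ z)/2)
    - Complex.log ((-Complex.I * (μ:ℂ) - Rf μ z)/2)
    + Complex.log (Omg α δ z - Rf μ z / 2) - Complex.log (Omg α δ z + Rf μ z / 2))
  - (2/(α:ℂ)) * (Complex.log (Omg α δ z - Rf μ z / 2) + Complex.log (Omg α δ z + Rf μ z / 2))

lemma HasDerivAt.const_mul_mul_log {f : ℂ → ℂ} {f' x : ℂ} (c : ℂ) (hf : HasDerivAt f f' x)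
    (hx : f x ∈ slitPlane) :
    HasDerivAt (fun y => c * f y * Complex.log (f y)) (c * f' * (Complex.log (f x) + 1)) x := by
  have hne := slitPlane_ne_zero hx
  refine ((hf.const_mul c).mul (hf.clog hx)).congr_deriv ?_
  field_simp

lemma hasDerivAt_Phi {α δ μ : ℝ} (hα : 0 < α) (hT2 : μ^2 > 4*(1 - α*δ)) (hT3 : 0 < μ) {z : ℂ}
    (hz : 0 < z.im) : HasDerivAt (Phi α δ μ) (dPhi α δ μ z) z := by
  have hα' : (α:ℂ) ≠ 0 := by exact_mod_cast hα.ne'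
  obtain ⟨hR1, hR2⟩ := Rf_re_im_pos μ hz
  have hR := hasDerivAt_Rf μ hz
  have hΩ : HasDerivAt (Omg α δ) (2 / (Complex.I * α)) z := by
    have h := ((hasDerivAt_id z).sub_const ((1 - α * δ) / 4 : ℂ)).const_mul
      (2 / (Complex.I * α))
    rw [mul_one] at h
    exact h
  have h1 : HasDerivAt (fun y : ℂ => (2/(α:ℂ)) * ((zP α δ μ : ℂ) - y)) (-(2/(α:ℂ))) z := by
    simpa using ((hasDerivAt_id z).const_sub (zP α δ μ : ℂ)).const_mul (2/(α:ℂ))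
  have s1 : (2/(α:ℂ)) * ((zP α δ μ : ℂ) - z) ∈ slitPlane := by
    right
    rw [show (2/(α:ℂ)) = ((2/α : ℝ) : ℂ) by push_cast; rfl, Complex.im_ofReal_mul]
    simpa using ⟨hα.ne', hz.ne'⟩
  have h2 : HasDerivAt (fun y : ℂ => (-Complex.I * (μ:ℂ) - Rf μ y)/2) (-(8 / Rf μ z)/2) z :=
    (hR.const_sub (-Complex.I * (μ:ℂ))).div_const 2
  have s2 : (-Complex.I * (μ:ℂ) - Rf μ z)/2 ∈ slitPlane := by
    right
    simp
    linarith
  have h3 : HasDerivAt (fun y : ℂ => (-Complex.I * (μ:ℂ) + Rf μ y)/2) ((8 / Rf μ z)/2) z :=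
    (hR.const_add (-Complex.I * (μ:ℂ))).div_const 2
  have s3 : (-Complex.I * (μ:ℂ) + Rf μ z)/2 ∈ slitPlane := by
    left
    simpa using hR1
  have h4 := hΩ.sub (hR.div_const 2)
  have s4 := Omg_sub_mem_slitPlane hα hT2 hz
  have h5 := hΩ.add (hR.div_const 2)
  have s5 : Omg α δ z + Rf μ z / 2 ∈ slitPlane := by
    left
    exact lt_trans (by positivity) (Omg_add_re hα δ μ hz)
  have H := ((((h1.const_mul_mul_log (-2) s1).const_add (-(μ:ℂ) * Complex.log 2)).add
    (h2.const_mul_mul_log Complex.I s2)).add (h3.const_mul_mul_log Complex.I s3)).sub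
    (h4.const_mul_mul_log Complex.I s4) |>.sub (h5.const_mul_mul_log Complex.I s5)
  refine (H.congr_deriv ?_).congr_of_eventuallyEq (Eventually.of_forall fun y => ?_)
  · have hne := Rf_ne_zero μ hz
    simp only [Pi.sub_apply, Pi.add_apply, dPhi]
    field_simp
    ring
  · simp only [Phi, Pi.sub_apply, Pi.add_apply]
    field_simp
    ring_nf
    simp only [Complex.I_sq]
    ring

/-! ### Growth of the derivative of `Φ` near the real axis -/

lemma exists_norm_log_le (B C : ℝ) {c : ℝ} (hc : 0 < c) :
    ∃ K, 0 ≤ K ∧ ∀ (ζ : ℂ) (y : ℝ), 0 < y → y ≤ B → c * y ^ 2 ≤ ‖ζ‖ → ‖ζ‖ ≤ C →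
      ‖Complex.log ζ‖ ≤ K * y ^ (-1/4 : ℝ) := by
  refine ⟨8 * (c⁻¹) ^ (1/8 : ℝ) + (|C| + π) * |B| ^ (1/4 : ℝ), by positivity, ?_⟩
  intro ζ y hy hyB hζ hζC
  have hr : 0 < ‖ζ‖ := lt_of_lt_of_le (by positivity) hζ
  have hB : 0 < B := hy.trans_le hyB
  have h1 : ‖Complex.log ζ‖ ≤ |Real.log ‖ζ‖| + π := by
    refine (Complex.norm_le_abs_re_add_abs_im _).trans ?_
    rw [Complex.log_re, Complex.log_im]
    gcongr
    exact Complex.abs_arg_le_pi ζ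
  have h2 : |Real.log ‖ζ‖| ≤ |C| + 8 * (c⁻¹) ^ (1/8 : ℝ) * y ^ (-1/4 : ℝ) := by
    have ha : Real.log ‖ζ‖ ≤ |C| :=
      ((Real.log_le_self hr.le).trans hζC).trans (le_abs_self C)
    have hb : -Real.log ‖ζ‖ ≤ 8 * (c⁻¹) ^ (1/8 : ℝ) * y ^ (-1/4 : ℝ) := by
      rw [← Real.log_inv]
      refine (Real.log_le_rpow_div (inv_nonneg.2 hr.le) (ε := 1/8) (by norm_num)).trans ?_
      have : (‖ζ‖⁻¹) ^ (1/8 : ℝ) ≤ (c⁻¹) ^ (1/8 : ℝ) * y ^ (-1/4 : ℝ) := by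
        have hy2 : y ^ (-1/4 : ℝ) = ((y ^ 2)⁻¹) ^ (1/8 : ℝ) := by
          rw [← Real.rpow_natCast, ← Real.rpow_neg hy.le, ← Real.rpow_mul hy.le]
          norm_num
        rw [hy2, ← Real.mul_rpow (by positivity) (by positivity), ← mul_inv]
        gcongr
      linarith
    have hc' : 0 ≤ 8 * (c⁻¹) ^ (1/8 : ℝ) * y ^ (-1/4 : ℝ) := by positivity
    rw [abs_le]
    constructor <;> linarith [abs_nonneg C]
  have h3 : 1 ≤ |B| ^ (1/4 : ℝ) * y ^ (-1/4 : ℝ) := by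
    rw [abs_of_pos hB, neg_div, Real.rpow_neg hy.le, ← div_eq_mul_inv, one_le_div (by positivity)]
    gcongr
  have h4 : |C| + π ≤ (|C| + π) * (|B| ^ (1/4 : ℝ) * y ^ (-1/4 : ℝ)) :=
    le_mul_of_one_le_right (by positivity) h3
  calc ‖Complex.log ζ‖ ≤ |C| + 8 * (c⁻¹) ^ (1/8 : ℝ) * y ^ (-1/4 : ℝ) + π := h1.trans (by gcongr)
    _ ≤ _ := by linarith

lemma sq_im_le_norm_Omg_sq_sub {α δ μ : ℝ} (hα : 0 < α) (hT2 : μ^2 > 4*(1 - α*δ)) (z : ℂ) :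
    4 / α ^ 2 * z.im ^ 2 ≤ ‖(Omg α δ z - Rf μ z / 2) * (Omg α δ z + Rf μ z / 2)‖ := by
  have hα' : (α:ℂ) ≠ 0 := by exact_mod_cast hα.ne'
  set e : ℝ := (1 - α * δ) / 4 - α ^ 2 / 2 with he
  set D : ℝ := α ^ 2 / 16 * (4 * α ^ 2 + μ ^ 2 - 4 * (1 - α * δ)) with hD
  have hD0 : 0 ≤ D := by
    have : 0 ≤ 4 * α ^ 2 + μ ^ 2 - 4 * (1 - α * δ) := by nlinarith [sq_nonneg α]
    positivity
  have hs : ((√D : ℝ) : ℂ) ^ 2 = D := by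
    rw [← Complex.ofReal_pow, Real.sq_sqrt hD0]
  have key : (Omg α δ z - Rf μ z / 2) * (Omg α δ z + Rf μ z / 2)
      = -((4 / α ^ 2 : ℝ) : ℂ) * ((z - ((e + √D : ℝ) : ℂ)) * (z - ((e - √D : ℝ) : ℂ))) := by
    have h1 : Omg α δ z ^ 2 = -((4 / α ^ 2 : ℝ) : ℂ) * (z - (1 - α * δ) / 4) ^ 2 := by
      rw [Omg]
      push_cast
      have := Complex.I_sq
      have hI := Complex.I_ne_zero
      rw [mul_pow, div_pow, mul_pow, this]
      field_simp
      ring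
    have h2 : (Omg α δ z - Rf μ z / 2) * (Omg α δ z + Rf μ z / 2)
        = Omg α δ z ^ 2 - Rf μ z ^ 2 / 4 := by ring
    have h3 : (z - ((e + √D : ℝ) : ℂ)) * (z - ((e - √D : ℝ) : ℂ)) = (z - e) ^ 2 - (D : ℂ) := by
      push_cast
      linear_combination -hs
    rw [h2, h3, h1, Rf_sq, he, hD]
    push_cast
    field_simp
    ring
  have hlow : ∀ a : ℝ, |z.im| ≤ ‖z - (a : ℂ)‖ := fun a => by
    simpa using Complex.abs_im_le_norm (z - (a : ℂ))
  rw [key, norm_mul, norm_mul, norm_neg, Complex.norm_of_nonneg (by positivity), ← sq_abs z.im,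
    pow_two |z.im|]
  exact mul_le_mul_of_nonneg_left (mul_le_mul (hlow _) (hlow _) (abs_nonneg _) (norm_nonneg _))
    (by positivity)

lemma exists_norm_dPhi_le {α δ μ : ℝ} (hα : 0 < α) (hT2 : μ^2 > 4*(1 - α*δ)) (hT3 : 0 < μ)
    (B : ℝ) : ∃ K, 0 ≤ K ∧ ∀ z : ℂ, 0 < z.im → ‖z‖ ≤ B →
      ‖dPhi α δ μ z‖ ≤ K * z.im ^ (-3/4 : ℝ) := by
  rcases le_or_gt B 0 with hB | hB
  · refine ⟨0, le_rfl, fun z hz hzB => ?_⟩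
    have := Complex.abs_im_le_norm z
    rw [abs_of_pos hz] at this
    linarith
  set CR : ℝ := 16 * B + μ ^ 2 + 1
  set C1 : ℝ := 2 / α * (|zP α δ μ| + B)
  set C2 : ℝ := (μ + CR) / 2
  set C5 : ℝ := 2 / α * (B + |1 - α * δ| / 4) + CR / 2
  have hCR : 0 < CR := by positivity
  have hC2 : 0 < C2 := by positivity
  have hC5 : 0 < C5 := by positivity
  obtain ⟨K1, hK1, H1⟩ := exists_norm_log_le B C1 (c := 2 / α / B) (by positivity)
  obtain ⟨K2, hK2, H2⟩ := exists_norm_log_le B C2 (c := μ / 2 / B ^ 2) (by positivity)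
  obtain ⟨K3, hK3, H3⟩ := exists_norm_log_le B C2 (c := 4 / C2 / B) (by positivity)
  obtain ⟨K4, hK4, H4⟩ := exists_norm_log_le B C5 (c := 4 / α ^ 2 / C5) (by positivity)
  obtain ⟨K5, hK5, H5⟩ := exists_norm_log_le B C5 (c := 2 / α / B) (by positivity)
  refine ⟨(4 / α * K1 + 2 / α * (K4 + K5)) * B ^ (1/2 : ℝ) + (K3 + K2 + K4 + K5),
    by positivity, fun z hz hzB => ?_⟩
  have hyB : z.im ≤ B := by
    have := Complex.abs_im_le_norm z
    rw [abs_of_pos hz] at this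
    linarith
  obtain ⟨hR1, hR2⟩ := Rf_re_im_pos μ hz
  have hRne := Rf_ne_zero μ hz
  set y := z.im with hy
  have hlin : ∀ a : ℝ, 0 < a → a / B * y ^ 2 ≤ a * y := fun a ha => by
    rw [div_mul_eq_mul_div, div_le_iff₀ hB]
    nlinarith [mul_pos ha hz]
  have hRn : ‖Rf μ z‖ ≤ CR := by
    have h : ‖Rf μ z‖ ^ 2 ≤ 16 * B + μ ^ 2 := by
      rw [← norm_pow, Rf_sq]
      refine (norm_sub_le _ _).trans ?_
      simp only [norm_mul, norm_pow, Complex.norm_real, Real.norm_eq_abs, sq_abs]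
      norm_num
      linarith
    nlinarith [sq_nonneg (‖Rf μ z‖ - 1)]
  have hRi : ‖4 * Complex.I / Rf μ z‖ ≤ y ^ (-1/2 : ℝ) := by
    have h : 16 * y ≤ ‖Rf μ z‖ ^ 2 := by
      rw [← norm_pow, Rf_sq]
      have := Complex.abs_im_le_norm (16 * z - (μ:ℂ) ^ 2)
      rw [← Complex.ofReal_pow] at this ⊢
      simp [-ofReal_pow] at this ⊢
      exact (le_abs_self _).trans (by simpa [abs_mul] using this)
    have h' : 4 * √y ≤ ‖Rf μ z‖ := by
      refine (pow_le_pow_iff_left₀ (by positivity) (norm_nonneg _) two_ne_zero).1 ?_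
      rw [mul_pow, Real.sq_sqrt hz.le]
      linarith
    have hsy : 0 < √y := Real.sqrt_pos.2 hz
    rw [neg_div, Real.rpow_neg hz.le, ← Real.sqrt_eq_rpow, norm_div, norm_mul, Complex.norm_I,
      inv_eq_one_div, div_le_div_iff₀ (by linarith) hsy]
    norm_num
    exact h'
  have hΩn : ‖Omg α δ z‖ ≤ 2 / α * (B + |1 - α * δ| / 4) := by
    rw [Omg, norm_mul]
    have h1 : ‖2 / (Complex.I * (α:ℂ))‖ = 2 / α := by simp [abs_of_pos hα]
    have h2 : (1 - α * δ : ℂ) / 4 = (((1 - α * δ) / 4 : ℝ) : ℂ) := by push_cast; rfl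
    rw [h1, h2]
    gcongr
    refine (norm_sub_le _ _).trans ?_
    rw [Complex.norm_real, Real.norm_eq_abs, abs_div]
    norm_num
    exact hzB
  have L1 := H1 ((2/(α:ℂ)) * ((zP α δ μ : ℂ) - z)) y hz hyB
    (by
      refine (hlin _ (by positivity)).trans ?_
      rw [norm_mul]
      have h1 : ‖(2:ℂ) / (α:ℂ)‖ = 2 / α := by simp [abs_of_pos hα]
      rw [h1]
      gcongr
      have := Complex.abs_im_le_norm ((zP α δ μ : ℂ) - z)
      simp at this
      exact (le_abs_self _).trans this)
    (by
      rw [norm_mul]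
      have h1 : ‖(2:ℂ) / (α:ℂ)‖ = 2 / α := by simp [abs_of_pos hα]
      rw [h1]
      refine mul_le_mul_of_nonneg_left ((norm_sub_le _ _).trans ?_) (by positivity)
      rw [Complex.norm_real, Real.norm_eq_abs]
      gcongr)
  have u2 : ‖(-Complex.I * (μ:ℂ) - Rf μ z)/2‖ ≤ C2 := by
    rw [norm_div, Complex.norm_two]
    refine div_le_div_of_nonneg_right ((norm_sub_le _ _).trans ?_) (by norm_num)
    simp [abs_of_pos hT3]
    exact hRn
  have u3 : ‖(-Complex.I * (μ:ℂ) + Rf μ z)/2‖ ≤ C2 := by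
    rw [norm_div, Complex.norm_two]
    refine div_le_div_of_nonneg_right ((norm_add_le _ _).trans ?_) (by norm_num)
    simp [abs_of_pos hT3]
    exact hRn
  have l2 : μ / 2 ≤ ‖(-Complex.I * (μ:ℂ) - Rf μ z)/2‖ := by
    have := Complex.abs_im_le_norm ((-Complex.I * (μ:ℂ) - Rf μ z)/2)
    refine le_trans ?_ this
    rw [le_abs]
    right
    simp
    linarith
  have L2 := H2 ((-Complex.I * (μ:ℂ) - Rf μ z)/2) y hz hyB
    (by
      refine le_trans ?_ l2
      rw [div_mul_eq_mul_div, div_le_iff₀ (by positivity)]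
      gcongr) u2
  have L3 := H3 ((-Complex.I * (μ:ℂ) + Rf μ z)/2) y hz hyB
    (by
      refine (hlin _ (by positivity)).trans ?_
      have hp : ‖(-Complex.I * (μ:ℂ) + Rf μ z)/2‖ * ‖(-Complex.I * (μ:ℂ) - Rf μ z)/2‖
          = 4 * ‖z‖ := by
        rw [← norm_mul]
        have : (-Complex.I * (μ:ℂ) + Rf μ z)/2 * ((-Complex.I * (μ:ℂ) - Rf μ z)/2) = -4 * z := by
          linear_combination (μ:ℂ) ^ 2 / 4 * Complex.I_sq - Rf_sq μ z / 4
        rw [this, norm_mul]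
        norm_num
      have hyz : y ≤ ‖z‖ := (le_abs_self _).trans (Complex.abs_im_le_norm z)
      rw [div_mul_eq_mul_div, div_le_iff₀ hC2]
      calc 4 * y ≤ 4 * ‖z‖ := by gcongr
        _ = _ := hp.symm
        _ ≤ _ := by gcongr) u3
  have u4 : ‖Omg α δ z - Rf μ z / 2‖ ≤ C5 := by
    refine (norm_sub_le _ _).trans ?_
    rw [norm_div, Complex.norm_two]
    exact add_le_add hΩn (by linarith)
  have u5 : ‖Omg α δ z + Rf μ z / 2‖ ≤ C5 := by
    refine (norm_add_le _ _).trans ?_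
    rw [norm_div, Complex.norm_two]
    exact add_le_add hΩn (by linarith)
  have L4 := H4 (Omg α δ z - Rf μ z / 2) y hz hyB
    (by
      have h := sq_im_le_norm_Omg_sq_sub hα hT2 (δ := δ) (μ := μ) z
      rw [norm_mul] at h
      rw [div_mul_eq_mul_div, div_le_iff₀ hC5]
      refine h.trans ?_
      gcongr) u4
  have L5 := H5 (Omg α δ z + Rf μ z / 2) y hz hyB
    ((hlin _ (by positivity)).trans ((Omg_add_re hα δ μ hz).le.trans (Complex.re_le_norm _))) u5
  have hq : y ^ (-1/4 : ℝ) ≤ B ^ (1/2 : ℝ) * y ^ (-3/4 : ℝ) := by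
    have : y ^ (-1/4 : ℝ) = y ^ (1/2 : ℝ) * y ^ (-3/4 : ℝ) := by
      rw [← Real.rpow_add hz]; norm_num
    rw [this]
    gcongr
  have hh : y ^ (-1/2 : ℝ) * y ^ (-1/4 : ℝ) = y ^ (-3/4 : ℝ) := by
    rw [← Real.rpow_add hz]; norm_num
  have hn4 : ‖(4:ℂ) / (α:ℂ)‖ = 4 / α := by simp [abs_of_pos hα]
  have hn2 : ‖(2:ℂ) / (α:ℂ)‖ = 2 / α := by simp [abs_of_pos hα]
  rw [dPhi]
  calc _ ≤ 4 / α * (K1 * y ^ (-1/4 : ℝ)) + y ^ (-1/2 : ℝ) * (K3 * y ^ (-1/4 : ℝ)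
        + K2 * y ^ (-1/4 : ℝ) + K4 * y ^ (-1/4 : ℝ) + K5 * y ^ (-1/4 : ℝ))
        + 2 / α * (K4 * y ^ (-1/4 : ℝ) + K5 * y ^ (-1/4 : ℝ)) := by
        refine (norm_sub_le _ _).trans (add_le_add ((norm_add_le _ _).trans (add_le_add ?_ ?_)) ?_)
        · rw [norm_mul, hn4]
          gcongr
        · rw [norm_mul]
          refine mul_le_mul hRi ?_ (norm_nonneg _) (by positivity)
          refine (norm_sub_le _ _).trans (add_le_add ((norm_add_le _ _).trans
            (add_le_add ((norm_sub_le _ _).trans (add_le_add L3 L2)) L4)) L5)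
        · rw [norm_mul, hn2]
          refine mul_le_mul_of_nonneg_left ((norm_add_le _ _).trans (add_le_add L4 L5))
            (by positivity)
    _ = (4 / α * K1 + 2 / α * (K4 + K5)) * y ^ (-1/4 : ℝ)
        + (K3 + K2 + K4 + K5) * y ^ (-3/4 : ℝ) := by rw [← hh]; ring
    _ ≤ (4 / α * K1 + 2 / α * (K4 + K5)) * (B ^ (1/2 : ℝ) * y ^ (-3/4 : ℝ))
        + (K3 + K2 + K4 + K5) * y ^ (-3/4 : ℝ) := by gcongr
    _ = _ := by ring

/-! ### The integrand of the moments as a function of independent endpoints -/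

/-- The integrand `h(s) (z₁ - q) / ((s - q)^(1/2) (s - r)^(1/2))` at `s = q + u (z₁ - q)`. -/
def kern (h : ℂ → ℂ) (z₁ : ℝ) (q r u : ℂ) : ℂ :=
  (z₁ - q) * h (q + u * (z₁ - q)) /
    ((u * (z₁ - q)) ^ ((1:ℂ)/2) * (q + u * (z₁ - q) - r) ^ ((1:ℂ)/2))

/-- The partial derivative of `kern` in `q`. -/
def kernQ (h : ℂ → ℂ) (z₁ : ℝ) (q r u : ℂ) : ℂ :=
  (1 - u) * kern (deriv h) z₁ q r u - kern h z₁ q r u / (2 * (z₁ - q))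
    - (1 - u) * kern h z₁ q r u / (2 * (q + u * (z₁ - q) - r))

/-- The partial derivative of `kern` in `r`. -/
def kernR (h : ℂ → ℂ) (z₁ : ℝ) (q r u : ℂ) : ℂ :=
  kern h z₁ q r u / (2 * (q + u * (z₁ - q) - r))

/-- The partial derivative of `kern` in `u`. -/
def kernU (h : ℂ → ℂ) (z₁ : ℝ) (q r u : ℂ) : ℂ :=
  (z₁ - q) * kern (deriv h) z₁ q r u - kern h z₁ q r u / (2 * u)
    - (z₁ - q) * kern h z₁ q r u / (2 * (q + u * (z₁ - q) - r))

lemma hasDerivAt_kern {h : ℂ → ℂ} {z₁ : ℝ} {Q R V : ℂ → ℂ} {Q' R' V' x : ℂ}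
    (hQ : HasDerivAt Q Q' x) (hR : HasDerivAt R R' x) (hV : HasDerivAt V V' x)
    (hX : V x * (z₁ - Q x) ∈ slitPlane) (hY : Q x + V x * (z₁ - Q x) - R x ∈ slitPlane)
    (hh : DifferentiableAt ℂ h (Q x + V x * (z₁ - Q x))) :
    HasDerivAt (fun y => kern h z₁ (Q y) (R y) (V y))
      (Q' * kernQ h z₁ (Q x) (R x) (V x) + R' * kernR h z₁ (Q x) (R x) (V x)
        + V' * kernU h z₁ (Q x) (R x) (V x)) x := by
  have hw : HasDerivAt (fun y => (z₁:ℂ) - Q y) (-Q') x := hQ.const_sub _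
  have hv := hV.mul hw
  have hs := hQ.add hv
  have hH : HasDerivAt (fun y => h (Q y + V y * (z₁ - Q y))) _ x := hh.hasDerivAt.comp x hs
  have hXne := slitPlane_ne_zero hX
  have hYne := slitPlane_ne_zero hY
  have hD := (hv.cpow_half hX).mul ((hs.sub hR).cpow_half hY)
  have hF := (hw.mul hH).div hD
    (mul_ne_zero (cpow_half_ne_zero hXne) (cpow_half_ne_zero hYne))
  refine hF.congr_deriv ?_
  have hX0 := cpow_half_ne_zero hXne
  have hY0 := cpow_half_ne_zero hYne
  have hX2 := cpow_half_sq (V x * (z₁ - Q x))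
  have hY2 := cpow_half_sq (Q x + V x * (z₁ - Q x) - R x)
  have hV0 := left_ne_zero_of_mul hXne
  have hw0 := right_ne_zero_of_mul hXne
  simp only [Pi.add_apply, Pi.mul_apply, Pi.sub_apply]
  simp only [kernQ, kernR, kernU, kern]
  generalize h (Q x + V x * (z₁ - Q x)) = a at *
  generalize deriv h (Q x + V x * (z₁ - Q x)) = b at *
  generalize (V x * (z₁ - Q x)) ^ ((1:ℂ)/2) = X at *
  generalize (Q x + V x * (z₁ - Q x) - R x) ^ ((1:ℂ)/2) = Y at *
  have e1 : Q x + V x * (z₁ - Q x) - R x = Y ^ 2 := hY2.symm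
  have e2 : (z₁:ℂ) - Q x = X ^ 2 / V x := by rw [hX2]; field_simp
  rw [e1, e2]
  field_simp
  ring

/-- Pointwise form of the integration by parts that removes the `q`-derivative. -/
lemma kernQ_id_mul_sub {h : ℂ → ℂ} {z₁ : ℝ} {q r u : ℂ}
    (hX : u * (z₁ - q) ∈ slitPlane) (hY : q + u * (z₁ - q) - r ∈ slitPlane)
    (hh : DifferentiableAt ℂ h (q + u * (z₁ - q))) :
    kernQ (fun s => s * h s) z₁ q r u - q * kernQ h z₁ q r u - kern h z₁ q r u / 2
      = (1 - 2 * u) * kern h z₁ q r u + u * (1 - u) * kernU h z₁ q r u := by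
  have hXne := slitPlane_ne_zero hX
  have hYne := slitPlane_ne_zero hY
  have hX0 := cpow_half_ne_zero hXne
  have hY0 := cpow_half_ne_zero hYne
  have hu0 := left_ne_zero_of_mul hXne
  have hw0 := right_ne_zero_of_mul hXne
  have hd : deriv (fun s => s * h s) (q + u * (z₁ - q))
      = h (q + u * (z₁ - q)) + (q + u * (z₁ - q)) * deriv h (q + u * (z₁ - q)) := by
    have h0 := ((hasDerivAt_id (q + u * (z₁ - q))).mul hh.hasDerivAt).deriv
    rw [one_mul] at h0
    exact h0
  simp only [kernQ, kernU, kern, hd]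
  field_simp
  ring

lemma kernR_id_mul {h : ℂ → ℂ} {z₁ : ℝ} {q r u : ℂ} (hY : q + u * (z₁ - q) - r ∈ slitPlane) :
    kernR (fun s => s * h s) z₁ q r u = r * kernR h z₁ q r u + kern h z₁ q r u / 2 := by
  have hYne := slitPlane_ne_zero hY
  have hk : kern (fun s => s * h s) z₁ q r u = (q + u * (z₁ - q)) * kern h z₁ q r u := by
    unfold kern
    ring
  rw [kernR, kernR, hk]
  generalize kern h z₁ q r u = k
  rw [mul_div_assoc', div_add_div _ _ (mul_ne_zero two_ne_zero hYne) two_ne_zero,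
    div_eq_div_iff (mul_ne_zero two_ne_zero hYne)
      (mul_ne_zero (mul_ne_zero two_ne_zero hYne) two_ne_zero)]
  ring

/-- The range of admissible endpoints. -/
def Admissible (z₁ : ℝ) (p : ℂ × ℂ) : Prop := 0 < p.1.im ∧ p.1.re < z₁ ∧ p.2.im < 0

lemma segment_im (q : ℂ) (z₁ u : ℝ) : (q + u * (z₁ - q)).im = (1 - u) * q.im := by
  simp
  ring

lemma segment_im_pos {q : ℂ} (z₁ : ℝ) {u : ℝ} (hq : 0 < q.im) (hu : u ∈ Ioo (0:ℝ) 1) :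
    0 < (q + u * (z₁ - q)).im := by
  rw [segment_im]
  exact mul_pos (by linarith [hu.2]) hq

lemma mul_sub_mem_slitPlane {q : ℂ} {z₁ u : ℝ} (hq : q.re < z₁) (hu : u ∈ Ioo (0:ℝ) 1) :
    (u:ℂ) * (z₁ - q) ∈ slitPlane := by
  left
  rw [Complex.re_ofReal_mul]
  exact mul_pos hu.1 (by simpa using hq)

lemma segment_sub_mem_slitPlane {q r : ℂ} (z₁ : ℝ) {u : ℝ} (hq : 0 < q.im) (hr : r.im < 0)
    (hu : u ∈ Ioo (0:ℝ) 1) : q + (u:ℂ) * (z₁ - q) - r ∈ slitPlane := by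
  right
  rw [Complex.sub_im]
  linarith [segment_im_pos z₁ hq hu]

lemma isOpen_im_pos : IsOpen {z : ℂ | 0 < z.im} := isOpen_lt continuous_const Complex.continuous_im

section Param

variable {h : ℂ → ℂ} {z₁ : ℝ} {p : ℂ × ℂ} {u : ℝ}

lemma hasDerivAt_kern_ofReal (hd : DifferentiableOn ℂ h {z | 0 < z.im}) (hp : Admissible z₁ p)
    (hu : u ∈ Ioo (0:ℝ) 1) :
    HasDerivAt (fun v : ℝ => kern h z₁ p.1 p.2 v) (kernU h z₁ p.1 p.2 u) u := by
  have := hasDerivAt_kern (h := h) (z₁ := z₁) (hasDerivAt_const (u:ℂ) p.1)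
    (hasDerivAt_const (u:ℂ) p.2) (hasDerivAt_id (u:ℂ)) (mul_sub_mem_slitPlane hp.2.1 hu)
    (segment_sub_mem_slitPlane z₁ hp.1 hp.2.2 hu)
    (hd.differentiableAt (isOpen_im_pos.mem_nhds (segment_im_pos z₁ hp.1 hu)))
  simpa using this.comp_ofReal

lemma continuousOn_kern (hd : DifferentiableOn ℂ h {z | 0 < z.im}) (hp : Admissible z₁ p) :
    ContinuousOn (fun v : ℝ => kern h z₁ p.1 p.2 v) (Ioo 0 1) := fun _ hu =>
  (hasDerivAt_kern_ofReal hd hp hu).continuousAt.continuousWithinAt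

lemma continuousOn_kernR (hd : DifferentiableOn ℂ h {z | 0 < z.im}) (hp : Admissible z₁ p) :
    ContinuousOn (fun v : ℝ => kernR h z₁ p.1 p.2 v) (Ioo 0 1) := by
  refine (continuousOn_kern hd hp).div (by fun_prop) fun u hu => ?_
  exact mul_ne_zero two_ne_zero
    (slitPlane_ne_zero (segment_sub_mem_slitPlane z₁ hp.1 hp.2.2 hu))

lemma continuousOn_kernQ (hd : DifferentiableOn ℂ h {z | 0 < z.im}) (hp : Admissible z₁ p) :
    ContinuousOn (fun v : ℝ => kernQ h z₁ p.1 p.2 v) (Ioo 0 1) := by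
  have hk := continuousOn_kern hd hp
  have hk' := continuousOn_kern (hd.deriv isOpen_im_pos) hp
  refine (((by fun_prop : Continuous fun v : ℝ => (1 - (v:ℂ))).continuousOn.mul hk').sub
    (hk.div_const _)).sub
    (((by fun_prop : Continuous fun v : ℝ => (1 - (v:ℂ))).continuousOn.mul hk).div (by fun_prop)
      fun u hu => ?_)
  exact mul_ne_zero two_ne_zero
    (slitPlane_ne_zero (segment_sub_mem_slitPlane z₁ hp.1 hp.2.2 hu))

lemma differentiableAt_kern (hd : DifferentiableOn ℂ h {z | 0 < z.im}) (hp : Admissible z₁ p)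
    (hu : u ∈ Ioo (0:ℝ) 1) :
    DifferentiableAt ℂ (fun p : ℂ × ℂ => kern h z₁ p.1 p.2 u) p := by
  have hX := mul_sub_mem_slitPlane hp.2.1 hu
  have hY := segment_sub_mem_slitPlane z₁ hp.1 hp.2.2 hu
  have hh := hd.differentiableAt (isOpen_im_pos.mem_nhds (segment_im_pos z₁ hp.1 hu))
  have hs : DifferentiableAt ℂ (fun p : ℂ × ℂ => p.1 + u * (z₁ - p.1)) p := by fun_prop
  have hH : DifferentiableAt ℂ (fun p : ℂ × ℂ => h (p.1 + u * (z₁ - p.1))) p :=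
    DifferentiableAt.comp p hh hs
  have h1 : DifferentiableAt ℂ (fun p : ℂ × ℂ => (u * (z₁ - p.1)) ^ ((1:ℂ)/2)) p :=
    DifferentiableAt.cpow (by fun_prop) (by fun_prop) hX
  have h2 : DifferentiableAt ℂ (fun p : ℂ × ℂ => (p.1 + u * (z₁ - p.1) - p.2) ^ ((1:ℂ)/2)) p :=
    DifferentiableAt.cpow (by fun_prop) (by fun_prop) hY
  unfold kern
  have hw : DifferentiableAt ℂ (fun p : ℂ × ℂ => (z₁:ℂ) - p.1) p := by fun_prop
  simp only [div_eq_mul_inv _ (_ * _)]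
  exact (hw.fun_mul hH).fun_mul <| (h1.fun_mul h2).fun_inv (mul_ne_zero (cpow_half_ne_zero (slitPlane_ne_zero hX))
      (cpow_half_ne_zero (slitPlane_ne_zero hY)))

lemma hasFDerivAt_kern (hd : DifferentiableOn ℂ h {z | 0 < z.im}) (hp : Admissible z₁ p)
    (hu : u ∈ Ioo (0:ℝ) 1) :
    HasFDerivAt (fun p : ℂ × ℂ => kern h z₁ p.1 p.2 u)
      (kernQ h z₁ p.1 p.2 u • ContinuousLinearMap.fst ℂ ℂ ℂ
        + kernR h z₁ p.1 p.2 u • ContinuousLinearMap.snd ℂ ℂ ℂ) p := by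
  have hX := mul_sub_mem_slitPlane hp.2.1 hu
  have hY := segment_sub_mem_slitPlane z₁ hp.1 hp.2.2 hu
  have hh := hd.differentiableAt (isOpen_im_pos.mem_nhds (segment_im_pos z₁ hp.1 hu))
  have hF := (differentiableAt_kern hd hp hu).hasFDerivAt
  refine hF.congr_fderiv (ContinuousLinearMap.ext fun v => ?_)
  have l1 : HasDerivAt (fun τ : ℂ => p.1 + τ * v.1) v.1 0 := by
    simpa using ((hasDerivAt_id (0:ℂ)).mul_const v.1).const_add p.1
  have l2 : HasDerivAt (fun τ : ℂ => p.2 + τ * v.2) v.2 0 := by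
    simpa using ((hasDerivAt_id (0:ℂ)).mul_const v.2).const_add p.2
  have hl : HasDerivAt (fun τ : ℂ => (p.1 + τ * v.1, p.2 + τ * v.2)) v 0 := l1.prodMk l2
  have c1 := HasFDerivAt.comp_hasDerivAt (0:ℂ) (by simpa using hF) hl
  have c2 := hasDerivAt_kern (h := h) (z₁ := z₁) l1 l2 (hasDerivAt_const (0:ℂ) (u:ℂ))
    (by simpa using hX) (by simpa using hY) (by simpa using hh)
  rw [c1.unique c2]
  simp [mul_comm]

/-- An integrable majorant for `h` along segments ending on the real axis. -/
def HasModerateGrowth (h : ℂ → ℂ) : Prop :=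
  ∀ B : ℝ, ∃ K, 0 ≤ K ∧ ∀ z : ℂ, 0 < z.im → ‖z‖ ≤ B → ‖h z‖ ≤ K * z.im ^ (-3/4 : ℝ)

lemma HasModerateGrowth.id_mul (hb : HasModerateGrowth h) :
    HasModerateGrowth (fun s => s * h s) := by
  intro B
  obtain ⟨K, hK, H⟩ := hb B
  refine ⟨|B| * K, by positivity, fun z hz hzB => ?_⟩
  rw [norm_mul, mul_assoc]
  exact mul_le_mul (hzB.trans (le_abs_self B)) (H z hz hzB) (norm_nonneg _) (abs_nonneg _)

lemma exists_ball_norm_kern_le (hb : HasModerateGrowth h) (hp : Admissible z₁ p) :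
    ∃ ρ > 0, ∃ M, 0 ≤ M ∧ ∀ p' ∈ Metric.ball p ρ, Admissible z₁ p' ∧ ∀ u ∈ Ioo (0:ℝ) 1,
      ‖kern h z₁ p'.1 p'.2 u‖ ≤ M * (u ^ (-1/2 : ℝ) * (1 - u) ^ (-3/4 : ℝ)) := by
  obtain ⟨h1, h2, h3⟩ := hp
  set mq : ℝ := p.1.im / 2
  set mw : ℝ := (z₁ - p.1.re) / 2
  set mr : ℝ := -p.2.im / 2
  have hmq : 0 < mq := by positivity
  have hmw : 0 < mw := by simp only [mw]; linarith
  have hmr : 0 < mr := by simp only [mr]; linarith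
  set ρ : ℝ := min mq (min mw mr)
  have hρ : 0 < ρ := lt_min hmq (lt_min hmw hmr)
  set B : ℝ := ‖p.1‖ + ρ + |z₁|
  obtain ⟨K, hK, H⟩ := hb B
  refine ⟨ρ, hρ, B * (K * mq ^ (-3/4 : ℝ)) / (√mw * √mr), by positivity, fun p' hp' => ?_⟩
  rw [← ball_prod_same, Set.mem_prod, mem_ball_iff_norm, mem_ball_iff_norm] at hp'
  obtain ⟨n1, n2⟩ := hp'
  have ρ1 : ρ ≤ mq := min_le_left _ _
  have ρ2 : ρ ≤ mw := (min_le_right _ _).trans (min_le_left _ _)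
  have ρ3 : ρ ≤ mr := (min_le_right _ _).trans (min_le_right _ _)
  have i1 := (abs_le.1 ((Complex.abs_im_le_norm _).trans n1.le))
  have i2 := (abs_le.1 ((Complex.abs_re_le_norm _).trans n1.le))
  have i3 := (abs_le.1 ((Complex.abs_im_le_norm _).trans n2.le))
  rw [Complex.sub_im] at i1 i3
  rw [Complex.sub_re] at i2
  have a1 : mq ≤ p'.1.im := by simp only [mq] at *; linarith [i1.1]
  have a2 : mw ≤ z₁ - p'.1.re := by simp only [mw] at *; linarith [i2.2]
  have a3 : mr ≤ -p'.2.im := by simp only [mr] at *; linarith [i3.2]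
  have hadm : Admissible z₁ p' := ⟨by linarith, by linarith, by linarith⟩
  refine ⟨hadm, fun u hu => ?_⟩
  obtain ⟨hu0, hu1⟩ := hu
  have hv : 0 < 1 - u := by linarith
  have np : ‖p'.1‖ ≤ ‖p.1‖ + ρ := by
    have := norm_sub_norm_le p'.1 p.1
    linarith
  have hs : ‖p'.1 + (u:ℂ) * (z₁ - p'.1)‖ ≤ B := by
    rw [show p'.1 + (u:ℂ) * (z₁ - p'.1) = ((1 - u : ℝ) : ℂ) * p'.1 + (u:ℂ) * (z₁:ℂ) by
      push_cast; ring]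
    refine (norm_add_le _ _).trans ?_
    rw [norm_mul, norm_mul, Complex.norm_of_nonneg hv.le, Complex.norm_of_nonneg hu0.le,
      Complex.norm_real, Real.norm_eq_abs]
    have := norm_nonneg p'.1
    have := abs_nonneg z₁
    simp only [B]
    nlinarith
  have hw : ‖(z₁:ℂ) - p'.1‖ ≤ B := by
    refine (norm_sub_le _ _).trans ?_
    rw [Complex.norm_real, Real.norm_eq_abs]
    simp only [B]
    linarith
  have hh : ‖h (p'.1 + (u:ℂ) * (z₁ - p'.1))‖ ≤ K * (mq ^ (-3/4 : ℝ) * (1 - u) ^ (-3/4 : ℝ)) := by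
    refine (H _ (segment_im_pos z₁ hadm.1 ⟨hu0, hu1⟩) hs).trans ?_
    rw [segment_im, ← Real.mul_rpow hmq.le hv.le]
    refine mul_le_mul_of_nonneg_left ?_ hK
    refine Real.rpow_le_rpow_of_nonpos (by positivity) ?_ (by norm_num)
    rw [mul_comm]
    gcongr
  have hX : √u * √mw ≤ ‖((u:ℂ) * (z₁ - p'.1)) ^ ((1:ℂ)/2)‖ := by
    refine (pow_le_pow_iff_left₀ (by positivity) (norm_nonneg _) two_ne_zero).1 ?_
    rw [norm_cpow_half_sq, mul_pow, Real.sq_sqrt hu0.le, Real.sq_sqrt hmw.le, norm_mul,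
      Complex.norm_of_nonneg hu0.le]
    gcongr
    refine a2.trans ?_
    have := Complex.re_le_norm ((z₁:ℂ) - p'.1)
    simpa using this
  have hY : √mr ≤ ‖(p'.1 + (u:ℂ) * (z₁ - p'.1) - p'.2) ^ ((1:ℂ)/2)‖ := by
    refine (pow_le_pow_iff_left₀ (by positivity) (norm_nonneg _) two_ne_zero).1 ?_
    rw [norm_cpow_half_sq, Real.sq_sqrt hmr.le]
    have h4 := (le_abs_self _).trans
      (Complex.abs_im_le_norm (p'.1 + (u:ℂ) * (z₁ - p'.1) - p'.2))
    have h5 := segment_im_pos z₁ hadm.1 ⟨hu0, hu1⟩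
    rw [Complex.sub_im] at h4
    linarith
  have hu' : u ^ (-1/2 : ℝ) = (√u)⁻¹ := by
    rw [neg_div, Real.rpow_neg hu0.le, Real.sqrt_eq_rpow]
  have hsu : 0 < √u := Real.sqrt_pos.2 hu0
  rw [kern, norm_div, norm_mul, norm_mul]
  calc _ ≤ B * (K * (mq ^ (-3/4 : ℝ) * (1 - u) ^ (-3/4 : ℝ))) / ((√u * √mw) * √mr) := by gcongr
    _ = _ := by
      rw [hu']
      field_simp

lemma integrableOn_beta_majorant :
    IntegrableOn (fun u : ℝ => u ^ (-1/2 : ℝ) * (1 - u) ^ (-3/4 : ℝ)) (Ioo 0 1) := by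
  have h := Complex.betaIntegral_convergent (u := ((1/2 : ℝ) : ℂ)) (v := ((1/4 : ℝ) : ℂ))
    (by simp) (by simp)
  rw [intervalIntegrable_iff_integrableOn_Ioo_of_le zero_le_one] at h
  refine IntegrableOn.congr_fun (Integrable.norm h) (fun u hu => ?_) measurableSet_Ioo
  obtain ⟨hu0, hu1⟩ := hu
  have hv : 0 < 1 - u := by linarith
  simp only [norm_mul]
  rw [show (1 - (u:ℂ)) = ((1 - u : ℝ) : ℂ) by push_cast; rfl,
    Complex.norm_cpow_eq_rpow_re_of_pos hu0, Complex.norm_cpow_eq_rpow_re_of_pos hv]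
  norm_num

lemma hasFDerivAt_integral_kern (hd : DifferentiableOn ℂ h {z | 0 < z.im})
    (hb : HasModerateGrowth h) (hp : Admissible z₁ p) :
    IntegrableOn (fun u : ℝ => kern h z₁ p.1 p.2 u) (Ioo 0 1) ∧
    IntegrableOn (fun u : ℝ => kernQ h z₁ p.1 p.2 u) (Ioo 0 1) ∧
    IntegrableOn (fun u : ℝ => kernR h z₁ p.1 p.2 u) (Ioo 0 1) ∧
    HasFDerivAt (fun p : ℂ × ℂ => ∫ u in Ioo (0:ℝ) 1, kern h z₁ p.1 p.2 u)
      ((∫ u in Ioo (0:ℝ) 1, kernQ h z₁ p.1 p.2 u) • ContinuousLinearMap.fst ℂ ℂ ℂ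
        + (∫ u in Ioo (0:ℝ) 1, kernR h z₁ p.1 p.2 u) • ContinuousLinearMap.snd ℂ ℂ ℂ) p := by
  obtain ⟨ρ, hρ, M, hM, H⟩ := exists_ball_norm_kern_le hb hp
  have hmeas : ∀ p', Admissible z₁ p' → AEStronglyMeasurable
      (fun u : ℝ => kern h z₁ p'.1 p'.2 u) (volume.restrict (Ioo 0 1)) := fun p' hp' =>
    (continuousOn_kern hd hp').aestronglyMeasurable measurableSet_Ioo
  have hint : IntegrableOn (fun u : ℝ => kern h z₁ p.1 p.2 u) (Ioo 0 1) := by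
    refine (integrableOn_beta_majorant.const_mul M).mono' (hmeas p hp) ?_
    exact ae_restrict_of_forall_mem measurableSet_Ioo
      (H p (Metric.mem_ball_self hρ)).2
  have hL := hasFDerivAt_integral_of_dominated_loc_of_lip' (𝕜 := ℂ)
    (μ := volume.restrict (Ioo (0:ℝ) 1))
    (F := fun (p : ℂ × ℂ) (u : ℝ) => kern h z₁ p.1 p.2 u) (x₀ := p)
    (F' := fun u : ℝ => kernQ h z₁ p.1 p.2 u • ContinuousLinearMap.fst ℂ ℂ ℂ
        + kernR h z₁ p.1 p.2 u • ContinuousLinearMap.snd ℂ ℂ ℂ)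
    (bound := fun u : ℝ => 2 / ρ * M * (u ^ (-1/2 : ℝ) * (1 - u) ^ (-3/4 : ℝ)))
    (Metric.ball_mem_nhds p hρ) (fun p' hp' => hmeas p' (H p' hp').1) hint
    ((((continuousOn_kernQ hd hp).smul continuousOn_const).add
      ((continuousOn_kernR hd hp).smul continuousOn_const)).aestronglyMeasurable measurableSet_Ioo)
    (ae_restrict_of_forall_mem measurableSet_Ioo fun u hu p' hp' => by
      set b : ℝ := M * (u ^ (-1/2 : ℝ) * (1 - u) ^ (-3/4 : ℝ)) with hbdef
      have := Complex.dist_le_div_mul_dist_of_mapsTo_ball (R₂ := 2 * b)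
        (f := fun p : ℂ × ℂ => kern h z₁ p.1 p.2 u) (c := p) (R₁ := ρ)
        (fun x hx => (differentiableAt_kern hd (H x hx).1 hu).differentiableWithinAt)
        (fun x hx => by
          rw [mem_closedBall_iff_norm]
          refine (norm_sub_le _ _).trans ?_
          linarith [(H x hx).2 u hu, (H p (Metric.mem_ball_self hρ)).2 u hu]) hp'
      rw [dist_eq_norm, dist_eq_norm] at this
      refine this.trans_eq ?_
      rw [hbdef]
      ring)
    (integrableOn_beta_majorant.const_mul _)
    (ae_restrict_of_forall_mem measurableSet_Ioo fun u hu => hasFDerivAt_kern hd hp hu)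
  have hQ : IntegrableOn (fun u : ℝ => kernQ h z₁ p.1 p.2 u) (Ioo 0 1) := by
    simpa [IntegrableOn] using hL.1.apply_continuousLinearMap ((1, 0) : ℂ × ℂ)
  have hR : IntegrableOn (fun u : ℝ => kernR h z₁ p.1 p.2 u) (Ioo 0 1) := by
    simpa [IntegrableOn] using hL.1.apply_continuousLinearMap ((0, 1) : ℂ × ℂ)
  refine ⟨hint, hQ, hR, hL.2.congr_fderiv ?_⟩
  rw [integral_add (hQ.smul_const _) (hR.smul_const _), integral_smul_const, integral_smul_const]

lemma integral_kernQ_id_mul (hd : DifferentiableOn ℂ h {z | 0 < z.im})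
    (hb : HasModerateGrowth h) (hp : Admissible z₁ p) :
    ∫ u in Ioo (0:ℝ) 1, kernQ (fun s => s * h s) z₁ p.1 p.2 u
      = p.1 * (∫ u in Ioo (0:ℝ) 1, kernQ h z₁ p.1 p.2 u)
        + (∫ u in Ioo (0:ℝ) 1, kern h z₁ p.1 p.2 u) / 2 := by
  obtain ⟨i0, iQ, -, -⟩ := hasFDerivAt_integral_kern hd hb hp
  have iQ1 : IntegrableOn (fun u : ℝ => kernQ (fun s => s * h s) z₁ p.1 p.2 u) (Ioo 0 1) :=
    (hasFDerivAt_integral_kern (differentiableOn_id.mul hd) hb.id_mul hp).2.1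
  obtain ⟨ρ, hρ, M, hM, H⟩ := exists_ball_norm_kern_le hb hp
  have hk := (H p (Metric.mem_ball_self hρ)).2
  set f : ℝ → ℂ := fun u => (u:ℂ) * (1 - u) * kern h z₁ p.1 p.2 u with hf
  set f' : ℝ → ℂ := fun u => kernQ (fun s => s * h s) z₁ p.1 p.2 u
    - p.1 * kernQ h z₁ p.1 p.2 u - kern h z₁ p.1 p.2 u / 2 with hf'
  have hder : ∀ u ∈ Ioo (0:ℝ) 1, HasDerivAt f (f' u) u := by
    intro u hu
    have h1 : HasDerivAt (fun u : ℝ => (u:ℂ) * (1 - u)) (1 - 2 * u) u := by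
      have h0 : HasDerivAt (fun v : ℝ => (v:ℂ)) 1 u := Complex.ofRealCLM.hasDerivAt
      refine (h0.mul (h0.const_sub 1)).congr_deriv ?_
      ring
    refine (h1.mul (hasDerivAt_kern_ofReal hd hp hu)).congr_deriv ?_
    rw [hf']
    simp only
    rw [kernQ_id_mul_sub (mul_sub_mem_slitPlane hp.2.1 hu)
      (segment_sub_mem_slitPlane z₁ hp.1 hp.2.2 hu)
      (hd.differentiableAt (isOpen_im_pos.mem_nhds (segment_im_pos z₁ hp.1 hu)))]
  have hfi : IntegrableOn f' (Ioo 0 1) := (iQ1.sub (iQ.const_mul p.1)).sub (i0.div_const 2)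
  have hbound : ∀ u ∈ Ioo (0:ℝ) 1, ‖f u‖ ≤ M * (u ^ (1/2 : ℝ) * (1 - u) ^ (1/4 : ℝ)) := by
    intro u hu
    have hv : 0 < 1 - u := by linarith [hu.2]
    have e1 : u ^ (1/2 : ℝ) = u * u ^ (-1/2 : ℝ) := by
      nth_rewrite 2 [← Real.rpow_one u]
      rw [← Real.rpow_add hu.1]; norm_num
    have e2 : (1 - u) ^ (1/4 : ℝ) = (1 - u) * (1 - u) ^ (-3/4 : ℝ) := by
      nth_rewrite 2 [← Real.rpow_one (1 - u)]
      rw [← Real.rpow_add hv]; norm_num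
    rw [hf]
    simp only [norm_mul]
    rw [show (1 - (u:ℂ)) = ((1 - u : ℝ) : ℂ) by push_cast; rfl, Complex.norm_of_nonneg hu.1.le,
      Complex.norm_of_nonneg hv.le, e1, e2]
    calc _ ≤ u * (1 - u) * (M * (u ^ (-1/2 : ℝ) * (1 - u) ^ (-3/4 : ℝ))) :=
          mul_le_mul_of_nonneg_left (hk u hu) (mul_nonneg hu.1.le hv.le)
      _ = _ := by ring
  have hcont : Continuous fun u : ℝ => M * (u ^ (1/2 : ℝ) * (1 - u) ^ (1/4 : ℝ)) :=
    continuous_const.mul ((continuous_id.rpow_const fun _ => Or.inr (by norm_num)).mul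
      ((continuous_const.sub continuous_id).rpow_const fun _ => Or.inr (by norm_num)))
  have l0 : Tendsto f (𝓝[>] 0) (𝓝 0) := by
    refine squeeze_zero_norm' (a := fun u : ℝ => M * (u ^ (1/2 : ℝ) * (1 - u) ^ (1/4 : ℝ))) ?_ ?_
    · filter_upwards [Ioo_mem_nhdsGT (zero_lt_one' ℝ)] with u hu using hbound u hu
    · refine Tendsto.mono_left ?_ nhdsWithin_le_nhds
      convert hcont.tendsto 0 using 2
      simp
  have l1 : Tendsto f (𝓝[<] 1) (𝓝 0) := by
    refine squeeze_zero_norm' (a := fun u : ℝ => M * (u ^ (1/2 : ℝ) * (1 - u) ^ (1/4 : ℝ))) ?_ ?_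
    · filter_upwards [Ioo_mem_nhdsLT (zero_lt_one' ℝ)] with u hu using hbound u hu
    · refine Tendsto.mono_left ?_ nhdsWithin_le_nhds
      convert hcont.tendsto 1 using 2
      simp
  have hI := intervalIntegral.integral_eq_sub_of_hasDerivAt_of_tendsto zero_lt_one hder
    ((intervalIntegrable_iff_integrableOn_Ioo_of_le zero_le_one).2 hfi) l0 l1
  have hsplit : ∫ u in Ioo (0:ℝ) 1, f' u
      = (∫ u in Ioo (0:ℝ) 1, kernQ (fun s => s * h s) z₁ p.1 p.2 u)
        - p.1 * (∫ u in Ioo (0:ℝ) 1, kernQ h z₁ p.1 p.2 u)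
        - (∫ u in Ioo (0:ℝ) 1, kern h z₁ p.1 p.2 u) / 2 := by
    have h1 := integral_sub (iQ1.sub (iQ.const_mul p.1)) (i0.div_const 2)
    have h2 := integral_sub iQ1 (iQ.const_mul p.1)
    simp only [Pi.sub_apply] at h1
    rw [h2, integral_const_mul, integral_div] at h1
    exact h1
  rw [intervalIntegral.integral_of_le zero_le_one, integral_Ioc_eq_integral_Ioo, hsplit] at hI
  linear_combination hI

lemma integral_kernR_id_mul (hd : DifferentiableOn ℂ h {z | 0 < z.im})
    (hb : HasModerateGrowth h) (hp : Admissible z₁ p) :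
    ∫ u in Ioo (0:ℝ) 1, kernR (fun s => s * h s) z₁ p.1 p.2 u
      = p.2 * (∫ u in Ioo (0:ℝ) 1, kernR h z₁ p.1 p.2 u)
        + (∫ u in Ioo (0:ℝ) 1, kern h z₁ p.1 p.2 u) / 2 := by
  obtain ⟨i0, -, iR, -⟩ := hasFDerivAt_integral_kern hd hb hp
  rw [← integral_const_mul, ← integral_div, ← integral_add (iR.const_mul _) (i0.div_const 2)]
  exact setIntegral_congr_fun measurableSet_Ioo fun u hu =>
    kernR_id_mul (segment_sub_mem_slitPlane z₁ hp.1 hp.2.2 hu)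

end Param

/-! ### Identification of the boundary value `S₊` -/

section BoundaryValue

variable {α δ μ : ℝ} {q : ℂ}

/-- The half-plane to the left of the line through `q` and `z₁`. -/
def leftOf (z₁ : ℝ) (q : ℂ) : Set ℂ :=
  {z | 0 < (z.im - q.im) * (z₁ - q.re) + (z.re - q.re) * q.im}

lemma convex_leftOf (z₁ : ℝ) (q : ℂ) : Convex ℝ (leftOf z₁ q) := by
  intro a ha b hb s t hs ht hst
  simp only [leftOf, mem_ofPred_eq] at *
  have e : ((s • a + t • b).im - q.im) * (z₁ - q.re) + ((s • a + t • b).re - q.re) * q.im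
      = s * ((a.im - q.im) * (z₁ - q.re) + (a.re - q.re) * q.im)
        + t * ((b.im - q.im) * (z₁ - q.re) + (b.re - q.re) * q.im) := by
    obtain rfl : s = 1 - t := by linarith
    simp
    ring
  rw [e]
  rcases hs.eq_or_lt with rfl | hs
  · obtain rfl : t = 1 := by linarith
    simpa using hb
  · have := mul_pos hs ha
    have := mul_nonneg ht hb.le
    linarith

lemma sub_mem_slitPlane_of_mem_leftOf {z₁ : ℝ} {z : ℂ} (hq : 0 < q.im)
    (hz : z ∈ leftOf z₁ q) : z - q ∈ slitPlane := by
  rw [leftOf, mem_ofPred_eq] at hz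
  rw [Complex.mem_slitPlane_iff, or_iff_not_imp_right, not_not, Complex.sub_im, Complex.sub_re]
  intro h
  rw [h, zero_mul, zero_add] at hz
  exact pos_of_mul_pos_left hz hq.le

lemma sub_conj_mem_slitPlane_of_mem_leftOf {z₁ : ℝ} {z : ℂ} (hq : 0 < q.im) (hq' : q.re < z₁)
    (hz : z ∈ leftOf z₁ q) : z - conj q ∈ slitPlane := by
  rw [leftOf, mem_ofPred_eq] at hz
  rw [Complex.mem_slitPlane_iff, or_iff_not_imp_right, not_not, Complex.sub_im, Complex.sub_re,
    Complex.conj_re, Complex.conj_im]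
  intro h
  have h1 : 0 < q.im * (z₁ - q.re) := mul_pos hq (by linarith)
  have h2 : z.im = -q.im := by linarith
  rw [h2] at hz
  refine pos_of_mul_pos_left (b := q.im) ?_ hq.le
  linarith

lemma leftOf_subset_compl (hq : 0 < q.im) (hq' : q.re < zP α δ μ) :
    leftOf (zP α δ μ) q ⊆
      (segB α δ μ q '' Set.Icc 0 1 ∪ segB α δ μ (conj q) '' Set.Icc 0 1)ᶜ := by
  rintro z hz (⟨u, hu, rfl⟩ | ⟨u, hu, rfl⟩) <;>
  · simp only [leftOf, segB, mem_ofPred_eq, Complex.add_im, Complex.add_re, Complex.im_ofReal_mul,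
      Complex.re_ofReal_mul, Complex.sub_im, Complex.sub_re, Complex.ofReal_re, Complex.ofReal_im,
      Complex.conj_re, Complex.conj_im] at hz
    have h1 : 0 < q.im * (zP α δ μ - q.re) := mul_pos hq (by linarith)
    have h2 := mul_nonneg h1.le (sub_nonneg.2 hu.2)
    nlinarith

lemma cpow_half_mul_cpow_half_conj {z : ℂ} (hz : z ∈ slitPlane) :
    z ^ ((1:ℂ)/2) * (conj z) ^ ((1:ℂ)/2) = (‖z‖ : ℂ) := by
  rw [Complex.conj_cpow _ _ (Complex.mem_slitPlane_iff_arg.1 hz).1]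
  have : conj ((1:ℂ)/2) = 1/2 := by simp [Complex.conj_ofNat]
  rw [this, Complex.mul_conj, Complex.normSq_eq_norm_sq, norm_cpow_half_sq]

lemma SSpec.eqOn_leftOf {S Splus : ℂ → ℂ} (hS : SSpec α δ μ q S Splus) (hq : 0 < q.im)
    (hq' : q.re < zP α δ μ) :
    EqOn S (fun z => (z - q) ^ ((1:ℂ)/2) * (z - conj q) ^ ((1:ℂ)/2)) (leftOf (zP α δ μ) q) := by
  obtain ⟨hd, hsq, hpos, -⟩ := hS
  have hsub := leftOf_subset_compl hq hq'
  set x : ℝ := zP α δ μ + 1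
  have hx : (x:ℂ) ∈ leftOf (zP α δ μ) q := by
    simp only [leftOf, mem_ofPred_eq, Complex.ofReal_re, Complex.ofReal_im, x]
    linarith
  refine (convex_leftOf _ q).isPreconnected.eq_of_sq_eq (hd.continuousOn.mono hsub) ?_ ?_ ?_ hx ?_
  · intro z hz
    have h1 : ContinuousAt (fun z : ℂ => z - q) z := by fun_prop
    have h2 : ContinuousAt (fun z : ℂ => z - conj q) z := by fun_prop
    exact ((h1.cpow continuousAt_const (sub_mem_slitPlane_of_mem_leftOf hq hz)).mul
      (h2.cpow continuousAt_const
        (sub_conj_mem_slitPlane_of_mem_leftOf hq hq' hz))).continuousWithinAt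
  · intro z hz
    simp only [Pi.pow_apply]
    rw [hsq z (hsub hz), mul_pow, cpow_half_sq, cpow_half_sq]
  · intro z hz
    exact mul_ne_zero
      (cpow_half_ne_zero (slitPlane_ne_zero (sub_mem_slitPlane_of_mem_leftOf hq hz)))
      (cpow_half_ne_zero (slitPlane_ne_zero (sub_conj_mem_slitPlane_of_mem_leftOf hq hq' hz)))
  · have h1 : (x:ℂ) - conj q = conj ((x:ℂ) - q) := by simp
    rw [hpos x (by simp [x]), h1, cpow_half_mul_cpow_half_conj (sub_mem_slitPlane_of_mem_leftOf hq hx),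
      Complex.norm_eq_sqrt_sq_add_sq]
    simp

lemma SSpec.splus_eq {S Splus : ℂ → ℂ} (hS : SSpec α δ μ q S Splus) (hq : 0 < q.im)
    (hq' : q.re < zP α δ μ) {u : ℝ} (hu : u ∈ Ioo (0:ℝ) 1) :
    Splus (segB α δ μ q u) = ((u:ℂ) * ((zP α δ μ : ℂ) - q)) ^ ((1:ℂ)/2)
      * (q + (u:ℂ) * ((zP α δ μ : ℂ) - q) - conj q) ^ ((1:ℂ)/2) := by
  have hlim := hS.2.2.2 u hu.1 hu.2
  set g : ℝ → ℂ := fun d => segB α δ μ q u + (d:ℂ) * Complex.I * ((zP α δ μ : ℂ) - q) with hg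
  have hgc : Continuous g := by fun_prop
  have hg0 : g 0 = segB α δ μ q u := by simp [hg]
  have hX : g 0 - q ∈ slitPlane := by
    rw [hg0, segB, add_sub_cancel_left]
    exact mul_sub_mem_slitPlane hq' hu
  have hY : g 0 - conj q ∈ slitPlane := by
    rw [hg0, segB]
    exact segment_sub_mem_slitPlane _ hq (by simpa using hq) hu
  have hP : ContinuousAt (fun d => (g d - q) ^ ((1:ℂ)/2) * (g d - conj q) ^ ((1:ℂ)/2)) 0 :=
    ((hgc.sub continuous_const).continuousAt.cpow continuousAt_const hX).mul
      ((hgc.sub continuous_const).continuousAt.cpow continuousAt_const hY)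
  have hP' := hP.tendsto.mono_left (nhdsWithin_le_nhds (s := Ioi (0:ℝ)))
  have heq : ∀ᶠ d in 𝓝[>] (0:ℝ),
      (g d - q) ^ ((1:ℂ)/2) * (g d - conj q) ^ ((1:ℂ)/2) = S (g d) := by
    filter_upwards [self_mem_nhdsWithin] with d hd
    refine (hS.eqOn_leftOf hq hq' ?_).symm
    have hd' : 0 < d := hd
    have h1 : 0 < zP α δ μ - q.re := by linarith
    have e : ((g d).im - q.im) * (zP α δ μ - q.re) + ((g d).re - q.re) * q.im
        = d * ((zP α δ μ - q.re)^2 + q.im^2) := by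
      simp [hg, segB]
      ring
    rw [leftOf, mem_ofPred_eq, e]
    positivity
  have := tendsto_nhds_unique hlim (hP'.congr' heq)
  rw [this, hg0, segB, add_sub_cancel_left]

end BoundaryValue

/-! ### The moments as integrals of `kern` -/

section Moments

variable {α δ μ : ℝ}

lemma differentiableOn_dPhi (hα : 0 < α) (hT2 : μ^2 > 4*(1 - α*δ)) (hT3 : 0 < μ) :
    DifferentiableOn ℂ (dPhi α δ μ) {z | 0 < z.im} := by
  have h : DifferentiableOn ℂ (Phi α δ μ) {z | 0 < z.im} := fun z hz =>
    (hasDerivAt_Phi hα hT2 hT3 hz).differentiableAt.differentiableWithinAt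
  exact (h.deriv isOpen_im_pos).congr fun z hz => (hasDerivAt_Phi hα hT2 hT3 hz).deriv.symm

lemma SSpec.Ip_eq {q : ℂ} {S Splus : ℂ → ℂ} (hα : 0 < α) (hT2 : μ^2 > 4*(1 - α*δ)) (hT3 : 0 < μ)
    (hS : SSpec α δ μ q S Splus) (hq : 0 < q.im) (hq' : q.re < zP α δ μ) (p : ℕ) :
    Ip α δ μ q Splus p =
      (∫ u in Ioo (0:ℝ) 1,
        kern (fun s => s ^ p * dPhi α δ μ s) (zP α δ μ) q (conj q) u).im := by
  rw [Ip, intervalIntegral.integral_of_le zero_le_one, integral_Ioc_eq_integral_Ioo]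
  congr 1
  refine setIntegral_congr_fun measurableSet_Ioo fun u hu => ?_
  rw [hS.splus_eq hq hq' hu, (hasDerivAt_Phi hα hT2 hT3
    (by rw [segB]; exact segment_im_pos _ hq hu)).deriv, kern, segB]
  ring

end Moments

/-! ### Differentiating the endpoint equations along a curve -/

section Curve

variable {h : ℂ → ℂ} {z₁ : ℝ} {c : ℝ → ℂ} {c' : ℂ} {s : ℝ}

lemma hasDerivAt_im_integral_kern (hd : DifferentiableOn ℂ h {z | 0 < z.im})
    (hb : HasModerateGrowth h) (hc : HasDerivAt c c' s) (him : 0 < (c s).im)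
    (hre : (c s).re < z₁) :
    HasDerivAt (fun y => (∫ u in Ioo (0:ℝ) 1, kern h z₁ (c y) (conj (c y)) u).im)
      ((∫ u in Ioo (0:ℝ) 1, kernQ h z₁ (c s) (conj (c s)) u) * c'
        + (∫ u in Ioo (0:ℝ) 1, kernR h z₁ (c s) (conj (c s)) u) * conj c').im s := by
  have hp : Admissible z₁ (c s, conj (c s)) := ⟨him, hre, by simpa using him⟩
  have hcc : HasDerivAt (fun y => (c y, conj (c y))) (c', conj c') s :=
    hc.prodMk ((Complex.conjCLE : ℂ →L[ℝ] ℂ).hasFDerivAt.comp_hasDerivAt s hc)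
  have h1 := ((hasFDerivAt_integral_kern hd hb hp).2.2.2.restrictScalars ℝ).comp_hasDerivAt s hcc
  have h2 := Complex.imCLM.hasFDerivAt.comp_hasDerivAt s h1
  exact h2.congr_deriv (by simp)

/-- Along a curve of solutions, the endpoint equations determine the velocity of the endpoint up
to a factor that does not depend on the curve. -/
lemma mul_velocity_eq {α : ℝ} (hα : 0 < α) {I0 I1 : ℂ → ℝ}
    (hd : DifferentiableOn ℂ h {z | 0 < z.im}) (hb : HasModerateGrowth h)
    (hI0 : ∀ q : ℂ, 0 < q.im → q.re < z₁ →
      I0 q = (∫ u in Ioo (0:ℝ) 1, kern h z₁ q (conj q) u).im)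
    (hI1 : ∀ q : ℂ, 0 < q.im → q.re < z₁ →
      I1 q = (∫ u in Ioo (0:ℝ) 1, kern (fun s => s * h s) z₁ q (conj q) u).im)
    {x t : ℝ → ℝ} {x' t' : ℝ} (hc : HasDerivAt c c' s) (hx : HasDerivAt x x' s)
    (ht : HasDerivAt t t' s)
    (H : ∀ᶠ y in 𝓝 s, 0 < (c y).im ∧ (c y).re < z₁ ∧ M0abs α I0 (c y) (x y) (t y) = 0 ∧
      M1abs α I1 (c y) (x y) (t y) = 0) :
    ((∫ u in Ioo (0:ℝ) 1, kernQ h z₁ (c s) (conj (c s)) u)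
        - conj (∫ u in Ioo (0:ℝ) 1, kernR h z₁ (c s) (conj (c s)) u)
        + 8 * π * t s / α^2 * Complex.I) * c'
      = ((4 * π / α^2 * ((c s).im * t') : ℝ) : ℂ)
        - ((2 * π / α^2 * (4 * (c s).re * t' + α * x' - t') : ℝ) : ℂ) * Complex.I := by
  obtain ⟨him, hre, hM0, -⟩ := H.self_of_nhds
  have hp : Admissible z₁ (c s, conj (c s)) := ⟨him, hre, by simpa using him⟩
  have hbm := hb.id_mul
  have hdm : DifferentiableOn ℂ (fun s => s * h s) {z | 0 < z.im} := differentiableOn_id.mul hd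
  have d0 := hasDerivAt_im_integral_kern hd hb hc him hre
  have d1 := hasDerivAt_im_integral_kern hdm hbm hc him hre
  have e1 := integral_kernQ_id_mul hd hb hp
  have e2 := integral_kernR_id_mul hd hb hp
  simp only at e1 e2
  rw [e1, e2] at d1
  rw [M0abs, hI0 _ him hre] at hM0
  set A := ∫ u in Ioo (0:ℝ) 1, kernQ h z₁ (c s) (conj (c s)) u
  set B := ∫ u in Ioo (0:ℝ) 1, kernR h z₁ (c s) (conj (c s)) u
  set G := ∫ u in Ioo (0:ℝ) 1, kern h z₁ (c s) (conj (c s)) u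
  have hcr : HasDerivAt (fun y => (c y).re) c'.re s :=
    Complex.reCLM.hasFDerivAt.comp_hasDerivAt s hc
  have hci : HasDerivAt (fun y => (c y).im) c'.im s :=
    Complex.imCLM.hasFDerivAt.comp_hasDerivAt s hc
  have D0 := ((((hcr.const_mul 4).mul ht).add (hx.const_mul α)).sub ht).const_mul (2 * π / α^2)
    |>.add d0
  have D1 := (((((hcr.pow 2).const_mul 8).sub ((hci.pow 2).const_mul 4)).mul ht).add
    ((hcr.const_mul 2).mul ((hx.const_mul α).sub ht))).const_mul (π / α^2) |>.add d1
  have Z0 := D0.unique ((hasDerivAt_const s (0:ℝ)).congr_of_eventuallyEq (by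
    filter_upwards [H] with y hy
    obtain ⟨y1, y2, y3, -⟩ := hy
    rw [M0abs, hI0 _ y1 y2] at y3
    simp only [Pi.add_apply, Pi.sub_apply, Pi.mul_apply]
    linear_combination y3))
  have Z1 := D1.unique ((hasDerivAt_const s (0:ℝ)).congr_of_eventuallyEq (by
    filter_upwards [H] with y hy
    obtain ⟨y1, y2, -, y4⟩ := hy
    have hsq : (c y ^ 2).re = (c y).re ^ 2 - (c y).im ^ 2 := by
      rw [pow_two, Complex.mul_re]
      ring
    rw [M1abs, hI1 _ y1 y2, ← Complex.normSq_eq_norm_sq, Complex.normSq_apply, hsq] at y4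
    simp only [Pi.add_apply, Pi.sub_apply, Pi.mul_apply, Pi.pow_apply]
    linear_combination y4))
  have hα0 := hα.ne'
  simp only [Complex.add_im, Complex.mul_im, Complex.add_re, Complex.mul_re, Complex.conj_re,
    Complex.conj_im, Complex.div_ofNat_re, Complex.div_ofNat_im, Pi.pow_apply, Pi.sub_apply]
    at Z0 Z1
  have hY : (A.im + B.im + 8 * π * t s / α^2) * c'.re + (A.re - B.re) * c'.im
      = -(2 * π / α^2 * (4 * (c s).re * t' + α * x' - t')) := by
    linear_combination Z0
  have hX : (A.re - B.re) * c'.re - (A.im + B.im + 8 * π * t s / α^2) * c'.im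
      = 4 * π / α^2 * ((c s).im * t') := by
    refine mul_left_cancel₀ him.ne' ?_
    linear_combination Z1 - (c s).re * hY - c'.re * hM0
  have hcoef : (8 * π * t s / α^2 : ℂ) = ((8 * π * t s / α^2 : ℝ) : ℂ) := by push_cast; rfl
  rw [hcoef]
  apply Complex.ext
  · simp only [Complex.add_im, Complex.mul_im, Complex.add_re, Complex.mul_re, Complex.conj_re,
      Complex.conj_im, Complex.sub_re, Complex.sub_im, Complex.ofReal_re, Complex.ofReal_im,
      Complex.I_re, Complex.I_im]
    linear_combination hX
  · simp only [Complex.add_im, Complex.mul_im, Complex.add_re, Complex.mul_re, Complex.conj_re,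
      Complex.conj_im, Complex.sub_re, Complex.sub_im, Complex.ofReal_re, Complex.ofReal_im,
      Complex.I_re, Complex.I_im]
    linear_combination hY

end Curve

/-- any differentiable solution of the endpoint equations satisfies the
elliptic Whitham equations. -/
theorem endpoint_solves_whitham (α δ μ : ℝ) (hα : 0 < α)
    (hT1 : α * |μ| > |1 - α*δ|) (hT2 : μ^2 > 4*(1 - α*δ)) (hT3 : 0 < μ)
    (I0 I1 : ℂ → ℝ)
    (hfam : ∀ q : ℂ, 0 < q.im → q.re < zP α δ μ →
      ∃ S Splus : ℂ → ℂ, SSpec α δ μ q S Splus ∧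
        I0 q = Ip α δ μ q Splus 0 ∧ I1 q = Ip α δ μ q Splus 1)
    (U : Set (ℝ × ℝ)) (hU : IsOpen U)
    (q : ℝ → ℝ → ℂ)
    (hdiff : ∀ x t : ℝ, (x, t) ∈ U →
      DifferentiableAt ℝ (fun p : ℝ × ℝ => q p.1 p.2) (x, t))
    (him : ∀ x t : ℝ, (x, t) ∈ U → 0 < (q x t).im)
    (hre : ∀ x t : ℝ, (x, t) ∈ U → (q x t).re < zP α δ μ)
    (hM0 : ∀ x t : ℝ, (x, t) ∈ U → M0abs α I0 (q x t) x t = 0)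
    (hM1 : ∀ x t : ℝ, (x, t) ∈ U → M1abs α I1 (q x t) x t = 0) :
    ∀ x t : ℝ, (x, t) ∈ U →
      deriv (fun τ => q x τ) t
        + (1/(α:ℂ)) * (1 - 3*q x t - conj (q x t)) * deriv (fun y => q y t) x = 0 ∧
      deriv (fun τ => conj (q x τ)) t
        + (1/(α:ℂ)) * (1 - 3*conj (q x t) - q x t) * deriv (fun y => conj (q y t)) x = 0 := by
  intro x t hxt
  have hd := differentiableOn_dPhi hα hT2 hT3
  have hb : HasModerateGrowth (dPhi α δ μ) := exists_norm_dPhi_le hα hT2 hT3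
  have hI0 : ∀ q : ℂ, 0 < q.im → q.re < zP α δ μ →
      I0 q = (∫ u in Ioo (0:ℝ) 1, kern (dPhi α δ μ) (zP α δ μ) q (conj q) u).im := by
    intro q h1 h2
    obtain ⟨S, Splus, hS, h0, -⟩ := hfam q h1 h2
    simpa only [pow_zero, one_mul] using h0.trans (hS.Ip_eq hα hT2 hT3 h1 h2 0)
  have hI1 : ∀ q : ℂ, 0 < q.im → q.re < zP α δ μ →
      I1 q = (∫ u in Ioo (0:ℝ) 1,
        kern (fun s => s * dPhi α δ μ s) (zP α δ μ) q (conj q) u).im := by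
    intro q h1 h2
    obtain ⟨S, Splus, hS, -, h0⟩ := hfam q h1 h2
    simpa only [pow_one] using h0.trans (hS.Ip_eq hα hT2 hT3 h1 h2 1)
  have lx : HasDerivAt (fun y : ℝ => (y, t)) ((1:ℝ), (0:ℝ)) x :=
    (hasDerivAt_id x).prodMk (hasDerivAt_const x t)
  have lt : HasDerivAt (fun τ : ℝ => (x, τ)) ((0:ℝ), (1:ℝ)) t :=
    (hasDerivAt_const t x).prodMk (hasDerivAt_id t)
  have qx : HasDerivAt (fun y => q y t) (deriv (fun y => q y t) x) x :=
    (DifferentiableAt.comp (g := fun p : ℝ × ℝ => q p.1 p.2) x (hdiff x t hxt)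
      lx.differentiableAt).hasDerivAt
  have qt : HasDerivAt (fun τ => q x τ) (deriv (fun τ => q x τ) t) t :=
    (DifferentiableAt.comp (g := fun p : ℝ × ℝ => q p.1 p.2) t (hdiff x t hxt)
      lt.differentiableAt).hasDerivAt
  have ex := mul_velocity_eq hα hd hb hI0 hI1 qx (hasDerivAt_id x) (hasDerivAt_const x t) (by
    filter_upwards [lx.continuousAt.preimage_mem_nhds (hU.mem_nhds hxt)] with y hy
    exact ⟨him y t hy, hre y t hy, hM0 y t hy, hM1 y t hy⟩)
  have et := mul_velocity_eq hα hd hb hI0 hI1 qt (hasDerivAt_const t x) (hasDerivAt_id t) (by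
    filter_upwards [lt.continuousAt.preimage_mem_nhds (hU.mem_nhds hxt)] with τ hτ
    exact ⟨him x τ hτ, hre x τ hτ, hM0 x τ hτ, hM1 x τ hτ⟩)
  simp only [id_eq] at ex et
  have hW : deriv (fun τ => q x τ) t
      + (1/(α:ℂ)) * (1 - 3*q x t - conj (q x t)) * deriv (fun y => q y t) x = 0 := by
    have hα0 : (α:ℂ) ≠ 0 := by exact_mod_cast hα.ne'
    have hπ : (π:ℂ) ≠ 0 := by exact_mod_cast Real.pi_ne_zero
    have hq : conj (q x t) = ((q x t).re : ℂ) - (q x t).im * Complex.I := by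
      apply Complex.ext <;> simp
    have hq' := Complex.re_add_im (q x t)
    generalize ((∫ u in Ioo (0:ℝ) 1, kernQ (dPhi α δ μ) (zP α δ μ) (q x t) (conj (q x t)) u)
        - conj (∫ u in Ioo (0:ℝ) 1, kernR (dPhi α δ μ) (zP α δ μ) (q x t) (conj (q x t)) u)
        + 8 * π * t / α^2 * Complex.I) = A at ex et
    have ex' : A * deriv (fun y => q y t) x = -(2 * π / α * Complex.I) := by
      rw [ex]
      push_cast
      field_simp
      ring
    have hA : A ≠ 0 := by
      rintro rfl
      rw [zero_mul, eq_comm, neg_eq_zero] at ex'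
      simp [hα0, hπ] at ex'
    refine mul_left_cancel₀ hA ?_
    rw [hq]
    nth_rewrite 1 [← hq']
    push_cast at et
    linear_combination et
      + (1/(α:ℂ)) * (1 - 4 * (q x t).re - 2 * (q x t).im * Complex.I) * ex'
      + 4 * π * (q x t).im / α^2 * Complex.I_sq
  refine ⟨hW, ?_⟩
  have cx : deriv (fun y => conj (q y t)) x = conj (deriv (fun y => q y t) x) :=
    ((Complex.conjCLE : ℂ →L[ℝ] ℂ).hasFDerivAt.comp_hasDerivAt x qx).deriv
  have ct : deriv (fun τ => conj (q x τ)) t = conj (deriv (fun τ => q x τ) t) :=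
    ((Complex.conjCLE : ℂ →L[ℝ] ℂ).hasFDerivAt.comp_hasDerivAt t qt).deriv
  rw [cx, ct]
  simpa [Complex.conj_ofNat] using congrArg conj hW
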